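/- arXiv:1103.0579 — 4 statements merged into one kernel-verified Lean document; each statement's English description precedes it below -/
import Mathlib

section
/- Let H₁ ∈ ℝ^{p₁×n}, H₂ ∈ ℝ^{p₂×n}, z₁ ∈ ℝ^{p₁}, z₂ ∈ ℝ^{p₂}, and suppose there exists x ∈ ℝⁿ with H₁ x = z₁ and H₂ x = z₂ (consistency). Let x̂₁ ∈ ℝⁿ satisfy H₁ x̂₁ = z₁ and x̂₁ ⟂ Ker(H₁). Let K be an n×k real matrix with orthonormal columns (Kᵀ K = I_k) whose column space equals Ker(H₁), and let P be the Moore–Penrose pseudoinverse of H₂ K. Then the updated vector x̂₂ := x̂₁ + K P (z₂ − H₂ x̂₁) satisfies: (i) H₁ x̂₂ = z₁, (ii) H₂ x̂₂ = z₂, and (iii) x̂₂ is orthogonal to Ker(H₁) ∩ Ker(H₂). -/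
open Matrix

/-- The four Moore–Penrose conditions characterizing the pseudoinverse `P` of `M`. -/
def IsPseudoinverse {m n : Type*} [Fintype m] [Fintype n]
    (M : Matrix m n ℝ) (P : Matrix n m ℝ) : Prop :=
  M * P * M = M ∧ P * M * P = P ∧ (M * P)ᵀ = M * P ∧ (P * M)ᵀ = P * M

/-- If `M *ᵥ w = 0`, then `w` is orthogonal to the range of the pseudoinverse of `M`. -/
theorem IsPseudoinverse.mulVec_dotProduct_eq_zero {m n : Type*} [Fintype m] [Fintype n]
    {M : Matrix m n ℝ} {P : Matrix n m ℝ} (hP : IsPseudoinverse M P)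
    (r : m → ℝ) {w : n → ℝ} (hw : M *ᵥ w = 0) : (P *ᵥ r) ⬝ᵥ w = 0 := by
  obtain ⟨-, hPMP, -, hsymm⟩ := hP
  calc (P *ᵥ r) ⬝ᵥ w = w ⬝ᵥ ((P * M) *ᵥ (P *ᵥ r)) := by
        rw [mulVec_mulVec, hPMP, dotProduct_comm]
    _ = ((P * M) *ᵥ w) ⬝ᵥ (P *ᵥ r) := by
        rw [dotProduct_mulVec, ← mulVec_transpose, hsymm]
    _ = 0 := by rw [← mulVec_mulVec, hw, mulVec_zero, zero_dotProduct]

/-- A matrix with orthonormal columns preserves dot products. -/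
theorem mulVec_dotProduct_mulVec_of_transpose_mul_self {m n : Type*} [Fintype m] [Fintype n]
    [DecidableEq n] {K : Matrix m n ℝ} (hK : Kᵀ * K = 1) (v w : n → ℝ) :
    (K *ᵥ v) ⬝ᵥ (K *ᵥ w) = v ⬝ᵥ w := by
  rw [dotProduct_mulVec, ← mulVec_transpose, mulVec_mulVec, hK, one_mulVec]

/-- the induction step of the incremental minimum norm algorithm.
Starting from the minimum norm solution `x̂₁` of `H₁ x = z₁`, the update
`x̂₂ = x̂₁ + K (H₂K)† (z₂ − H₂ x̂₁)` solves both blocks and is orthogonal to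
`Ker(H₁) ∩ Ker(H₂)`. -/
theorem incremental_update_step {p₁ p₂ n k : ℕ}
    (H₁ : Matrix (Fin p₁) (Fin n) ℝ) (H₂ : Matrix (Fin p₂) (Fin n) ℝ)
    (z₁ : Fin p₁ → ℝ) (z₂ : Fin p₂ → ℝ)
    (hcons : ∃ x : Fin n → ℝ, H₁ *ᵥ x = z₁ ∧ H₂ *ᵥ x = z₂)
    (xhat₁ : Fin n → ℝ)
    (hx₁ : H₁ *ᵥ xhat₁ = z₁)
    (hx₁perp : ∀ y : Fin n → ℝ, H₁ *ᵥ y = 0 → xhat₁ ⬝ᵥ y = 0)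
    (K : Matrix (Fin n) (Fin k) ℝ)
    (hKorth : Kᵀ * K = 1)
    (hKrange : LinearMap.range K.mulVecLin = LinearMap.ker H₁.mulVecLin)
    (P : Matrix (Fin k) (Fin p₂) ℝ)
    (hP : IsPseudoinverse (H₂ * K) P)
    (xhat₂ : Fin n → ℝ)
    (hx₂ : xhat₂ = xhat₁ + K *ᵥ (P *ᵥ (z₂ - H₂ *ᵥ xhat₁))) :
    H₁ *ᵥ xhat₂ = z₁ ∧ H₂ *ᵥ xhat₂ = z₂ ∧
      ∀ y : Fin n → ℝ, H₁ *ᵥ y = 0 → H₂ *ᵥ y = 0 → xhat₂ ⬝ᵥ y = 0 := by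
  have hK_mem : ∀ v, H₁ *ᵥ (K *ᵥ v) = 0 := fun v => by
    have hv : K.mulVecLin v ∈ LinearMap.ker H₁.mulVecLin := hKrange ▸ ⟨v, rfl⟩
    exact hv
  have hK_surj : ∀ y, H₁ *ᵥ y = 0 → ∃ w, K *ᵥ w = y := fun y hy => by
    have hy' : y ∈ LinearMap.range K.mulVecLin := hKrange ▸ hy
    exact hy'
  subst hx₂
  refine ⟨by rw [mulVec_add, hK_mem, add_zero, hx₁], ?_, ?_⟩
  · obtain ⟨x, hx, hxz⟩ := hcons
    obtain ⟨u, hu⟩ := hK_surj (x - xhat₁) (by rw [mulVec_sub, hx, hx₁, sub_self])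
    have hr : z₂ - H₂ *ᵥ xhat₁ = (H₂ * K) *ᵥ u := by
      rw [← mulVec_mulVec, hu, mulVec_sub, hxz]
    have hres : H₂ *ᵥ (K *ᵥ (P *ᵥ (z₂ - H₂ *ᵥ xhat₁))) = z₂ - H₂ *ᵥ xhat₁ := by
      rw [hr, mulVec_mulVec _ H₂ K, mulVec_mulVec, mulVec_mulVec, hP.1]
    rw [mulVec_add, hres, add_sub_cancel]
  · intro y hy₁ hy₂
    obtain ⟨w, rfl⟩ := hK_surj y hy₁
    rw [add_dotProduct, hx₁perp _ hy₁, zero_add,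
      mulVec_dotProduct_mulVec_of_transpose_mul_self hKorth]
    exact hP.mulVec_dotProduct_eq_zero _ (by rw [← mulVec_mulVec, hy₂])
end

section
/- Let H be a real p×n matrix and B a real p×q matrix of full row rank (so that B Bᵀ is invertible). Let H† be the Moore–Penrose pseudoinverse of H and let M = (I_p − H H†) B, with Moore–Penrose pseudoinverse M†. Then Hᵀ (B Bᵀ)⁻¹ B M† (I_p − H H†) B = 0. -/
open Matrix

/-- The Gram matrix `B Bᵀ` of a real matrix with linearly independent rows is invertible. -/
theorem isUnit_det_mul_transpose_self {m n : Type*} [Fintype m] [DecidableEq m] [Fintype n]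
    {B : Matrix m n ℝ} (hB : LinearIndependent ℝ B.row) : IsUnit (B * Bᵀ).det := by
  have h := Matrix.PosDef.mul_conjTranspose_self B (Matrix.vecMul_injective_iff.mpr hB)
  rw [conjTranspose_eq_transpose_of_trivial] at h
  exact (isUnit_iff_isUnit_det _).mp h.isUnit

/-- with `M = (I − H H†) B` and `B` of full row rank,
`Hᵀ (B Bᵀ)⁻¹ B M† (I − H H†) B = 0`. -/
theorem pseudoinverse_complement_annihilation {p n q : ℕ}
    (H : Matrix (Fin p) (Fin n) ℝ) (B : Matrix (Fin p) (Fin q) ℝ)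
    (hB : LinearIndependent ℝ B)
    (Hd : Matrix (Fin n) (Fin p) ℝ) (hHd : IsPseudoinverse H Hd)
    (M : Matrix (Fin p) (Fin q) ℝ) (hM : M = (1 - H * Hd) * B)
    (Md : Matrix (Fin q) (Fin p) ℝ) (hMd : IsPseudoinverse M Md) :
    Hᵀ * (B * Bᵀ)⁻¹ * B * Md * ((1 - H * Hd) * B) = 0 := by
  obtain ⟨hH, -, hsymm, -⟩ := hHd
  have hdet : IsUnit (B * Bᵀ).det := isUnit_det_mul_transpose_self hB
  have hrange : Hᵀ * (1 - H * Hd) = 0 := by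
    rw [← hsymm, ← transpose_one, ← transpose_sub, ← transpose_mul, Matrix.sub_mul,
      Matrix.one_mul, hH, sub_self, transpose_zero]
  have hproj : Md * M = Bᵀ * ((1 - H * Hd) * Mdᵀ) := by
    rw [← hMd.2.2.2, transpose_mul, hM, transpose_mul, transpose_sub, transpose_one, hsymm,
      Matrix.mul_assoc]
  calc Hᵀ * (B * Bᵀ)⁻¹ * B * Md * ((1 - H * Hd) * B)
      = Hᵀ * ((B * Bᵀ)⁻¹ * (B * Bᵀ)) * ((1 - H * Hd) * Mdᵀ) := by
        rw [← hM, Matrix.mul_assoc _ Md M, hproj]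
        simp only [Matrix.mul_assoc]
    _ = 0 := by
        rw [nonsing_inv_mul _ hdet, Matrix.mul_one, ← Matrix.mul_assoc, hrange, Matrix.zero_mul]
end

section
/- Let H be a real p×n matrix with Ker(H) = {0}, and let B be a real p×q matrix of full row rank. Set Σ = B Bᵀ, let H† = (Hᵀ H)⁻¹ Hᵀ be the Moore–Penrose pseudoinverse of H, and let M† be the Moore–Penrose pseudoinverse of M = (I_p − H H†) B. Then H† − H† B M† = (Hᵀ Σ⁻¹ H)⁻¹ Hᵀ Σ⁻¹. -/
open Matrix

/-- Right-multiplying the pseudoinverse of `M` by a matrix whose columns are orthogonal to the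
range of `M` gives zero. -/
lemma IsPseudoinverse.mul_eq_zero {m n k : Type*} [Fintype m] [Fintype n]
    {M : Matrix m n ℝ} {P : Matrix n m ℝ} (h : IsPseudoinverse M P) {H : Matrix m k ℝ}
    (hMH : Mᵀ * H = 0) : P * H = 0 := by
  obtain ⟨-, h2, h3, -⟩ := h
  rw [← h2, Matrix.mul_assoc P, ← h3, transpose_mul]
  simp [Matrix.mul_assoc, hMH]

lemma IsPseudoinverse.mul_mul_transpose {m n : Type*} [Fintype m] [Fintype n]
    {M : Matrix m n ℝ} {P : Matrix n m ℝ} (h : IsPseudoinverse M P) :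
    P * M * Mᵀ = Mᵀ := by
  obtain ⟨h1, -, -, h4⟩ := h
  rw [← h4, ← transpose_mul, ← Matrix.mul_assoc, h1]

/-- core of Theorem 2: with `H† = (HᵀH)⁻¹Hᵀ`, `Σ = BBᵀ` and
`M = (I − H H†)B`, one has `H† − H† B M† = (Hᵀ Σ⁻¹ H)⁻¹ Hᵀ Σ⁻¹`. -/
theorem limit_is_weighted_least_squares {p n q : ℕ}
    (H : Matrix (Fin p) (Fin n) ℝ)
    (hH : ∀ x : Fin n → ℝ, H *ᵥ x = 0 → x = 0)
    (B : Matrix (Fin p) (Fin q) ℝ)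
    (hB : LinearIndependent ℝ B)
    (S : Matrix (Fin p) (Fin p) ℝ) (hS : S = B * Bᵀ)
    (Hd : Matrix (Fin n) (Fin p) ℝ) (hHd : Hd = (Hᵀ * H)⁻¹ * Hᵀ)
    (M : Matrix (Fin p) (Fin q) ℝ) (hM : M = (1 - H * Hd) * B)
    (Md : Matrix (Fin q) (Fin p) ℝ) (hMd : IsPseudoinverse M Md) :
    Hd - Hd * B * Md = (Hᵀ * S⁻¹ * H)⁻¹ * Hᵀ * S⁻¹ := by
  have hG : IsUnit (Hᵀ * H).det := by
    have h := PosDef.conjTranspose_mul_self H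
      ((injective_iff_map_eq_zero H.mulVecLin).2 hH)
    rw [conjTranspose_eq_transpose_of_trivial] at h
    exact (isUnit_iff_isUnit_det _).1 h.isUnit
  have hSu : IsUnit S.det := by
    have h := PosDef.mul_conjTranspose_self B (vecMul_injective_iff.2 hB)
    rw [conjTranspose_eq_transpose_of_trivial, ← hS] at h
    exact (isUnit_iff_isUnit_det _).1 h.isUnit
  have hHdH : Hd * H = 1 := by
    rw [hHd, Matrix.mul_assoc, nonsing_inv_mul _ hG]
  have hsymm : (H * Hd)ᵀ = H * Hd := by
    rw [hHd]
    simp [transpose_mul, transpose_nonsing_inv, Matrix.mul_assoc]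
  have hMt : Mᵀ = Bᵀ * (1 - H * Hd) := by
    rw [hM, transpose_mul, transpose_sub, hsymm, transpose_one]
  have hMdH : Md * H = 0 := hMd.mul_eq_zero <| by
    rw [hMt, Matrix.mul_assoc, Matrix.sub_mul, Matrix.mul_assoc H, hHdH]
    simp
  have hMdB : Md * B = Md * M := by
    rw [hM, ← Matrix.mul_assoc, Matrix.mul_sub, ← Matrix.mul_assoc, hMdH]
    simp
  set X := Hd - Hd * B * Md with hX
  have hXH : X * H = 1 := by
    rw [hX, Matrix.sub_mul, Matrix.mul_assoc _ Md, hMdH, hHdH]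
    simp
  have hXS : X * S * (1 - H * Hd) = 0 := by
    rw [hS, Matrix.mul_assoc, Matrix.mul_assoc B, ← hMt, hX, Matrix.sub_mul, sub_eq_zero,
      Matrix.mul_assoc _ Md, ← Matrix.mul_assoc Md, hMdB, hMd.mul_mul_transpose,
      Matrix.mul_assoc]
  obtain ⟨C, hC⟩ : ∃ C : Matrix (Fin n) (Fin n) ℝ, X = C * Hᵀ * S⁻¹ := by
    refine ⟨X * S * H * (Hᵀ * H)⁻¹, ?_⟩
    rw [Matrix.mul_sub, Matrix.mul_one, sub_eq_zero, hHd] at hXS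
    rw [Matrix.mul_assoc _ _ Hᵀ, Matrix.mul_assoc (X * S), ← hXS,
      mul_nonsing_inv_cancel_right _ _ hSu]
  have hinv : (Hᵀ * S⁻¹ * H)⁻¹ = C := inv_eq_left_inv <| by
    rw [← hXH, hC]
    simp only [Matrix.mul_assoc]
  rw [hinv, hC]
end

section
/- Let H be a real p×n matrix with Ker(H) = {0}, let B be a real p×q matrix of full row rank, set Σ = B Bᵀ, and let z ∈ ℝ^p. For each ε > 0, the linear system H x + ε B w = z (in the unknowns x ∈ ℝⁿ, w ∈ ℝ^q) is consistent, and has a unique solution (x(ε), w(ε)) that is orthogonal to the null space of the block matrix [H εB]. Then x(ε) converges, as ε → 0⁺, to the weighted least squares estimate x_wls = (Hᵀ Σ⁻¹ H)⁻¹ Hᵀ Σ⁻¹ z. -/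
open Matrix

/-- The regularized normal equations `(Hᵀ S⁻¹ H + ε² I) x = Hᵀ S⁻¹ z`, together with
`w = ε⁻¹ Bᵀ S⁻¹ (z - H x)`, produce a solution of `H x + ε B w = z` orthogonal to the null space
of `[H εB]`. -/
theorem regularized_solution {p n q : ℕ} (H : Matrix (Fin p) (Fin n) ℝ)
    (B : Matrix (Fin p) (Fin q) ℝ) (S : Matrix (Fin p) (Fin p) ℝ) (hS : S = B * Bᵀ)
    (hdet : IsUnit S.det) (z : Fin p → ℝ) {ε : ℝ} (hε : ε ≠ 0) (x : Fin n → ℝ)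
    (hx : (Hᵀ * S⁻¹ * H + ε ^ 2 • 1) *ᵥ x = (Hᵀ * S⁻¹) *ᵥ z) :
    H *ᵥ x + ε • (B *ᵥ (ε⁻¹ • (Bᵀ *ᵥ (S⁻¹ *ᵥ (z - H *ᵥ x))))) = z ∧
      ∀ (y : Fin n → ℝ) (u : Fin q → ℝ), H *ᵥ y + ε • (B *ᵥ u) = 0 →
        x ⬝ᵥ y + (ε⁻¹ • (Bᵀ *ᵥ (S⁻¹ *ᵥ (z - H *ᵥ x)))) ⬝ᵥ u = 0 := by
  set r : Fin p → ℝ := S⁻¹ *ᵥ (z - H *ᵥ x) with hr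
  constructor
  · rw [mulVec_smul, smul_smul, mul_inv_cancel₀ hε, one_smul, mulVec_mulVec, ← hS, hr,
      mulVec_mulVec, mul_nonsing_inv _ hdet, one_mulVec]
    abel
  · intro y u hyu
    have hHr : Hᵀ *ᵥ r = ε ^ 2 • x := by
      rw [add_mulVec, smul_mulVec, one_mulVec] at hx
      rw [hr, mulVec_sub, mulVec_sub, mulVec_mulVec, mulVec_mulVec, mulVec_mulVec, ← hx]
      abel
    have h1 : r ⬝ᵥ (H *ᵥ y) = ε ^ 2 * (x ⬝ᵥ y) := by
      rw [dotProduct_mulVec, ← mulVec_transpose, hHr, smul_dotProduct, smul_eq_mul]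
    have h2 : r ⬝ᵥ (B *ᵥ u) = (Bᵀ *ᵥ r) ⬝ᵥ u := by
      rw [dotProduct_mulVec, ← mulVec_transpose]
    have h3 := congrArg (fun v => r ⬝ᵥ v) hyu
    simp only [dotProduct_add, dotProduct_smul, dotProduct_zero, smul_eq_mul, h1, h2] at h3
    rw [smul_dotProduct, smul_eq_mul]
    field_simp
    apply mul_left_cancel₀ hε
    linear_combination h3

/-- A linear system has at most one solution orthogonal to the null space of its coefficient
matrix, here of the block form `[A C]`. -/
theorem orthogonal_solution_unique {p n q : ℕ} (A : Matrix (Fin p) (Fin n) ℝ)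
    (C : Matrix (Fin p) (Fin q) ℝ) (c : ℝ) (z : Fin p → ℝ) {x x' : Fin n → ℝ} {w w' : Fin q → ℝ}
    (h : A *ᵥ x + c • (C *ᵥ w) = z)
    (ho : ∀ (y : Fin n → ℝ) (u : Fin q → ℝ),
      A *ᵥ y + c • (C *ᵥ u) = 0 → x ⬝ᵥ y + w ⬝ᵥ u = 0)
    (h' : A *ᵥ x' + c • (C *ᵥ w') = z)
    (ho' : ∀ (y : Fin n → ℝ) (u : Fin q → ℝ),
      A *ᵥ y + c • (C *ᵥ u) = 0 → x' ⬝ᵥ y + w' ⬝ᵥ u = 0) :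
    (x', w') = (x, w) := by
  have hker : A *ᵥ (x' - x) + c • (C *ᵥ (w' - w)) = 0 := by
    rw [mulVec_sub, mulVec_sub, smul_sub, ← sub_self z]
    nth_rewrite 1 [← h']
    rw [← h]
    abel
  have h1 := ho _ _ hker
  have h2 := ho' _ _ hker
  have hsum : (x' - x) ⬝ᵥ (x' - x) + (w' - w) ⬝ᵥ (w' - w) = 0 := by
    rw [sub_dotProduct x' x, sub_dotProduct w' w]
    linear_combination h2 - h1
  have nonneg {m : ℕ} (v : Fin m → ℝ) : 0 ≤ v ⬝ᵥ v :=
    Finset.sum_nonneg fun i _ => mul_self_nonneg (v i)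
  obtain ⟨hx, hw⟩ := (add_eq_zero_iff_of_nonneg (nonneg _) (nonneg _)).1 hsum
  rw [sub_eq_zero.1 (dotProduct_self_eq_zero.1 hx), sub_eq_zero.1 (dotProduct_self_eq_zero.1 hw)]

/-- Theorem 2, convergence with ε: for each `ε > 0` the system
`Hx + εBw = z` has a unique solution orthogonal to the null space of `[H εB]`,
and its `x`-block converges, as `ε → 0⁺`, to the weighted least squares estimate
`x_wls = (Hᵀ Σ⁻¹ H)⁻¹ Hᵀ Σ⁻¹ z`. -/
theorem convergence_with_epsilon {p n q : ℕ}
    (H : Matrix (Fin p) (Fin n) ℝ)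
    (hH : ∀ x : Fin n → ℝ, H *ᵥ x = 0 → x = 0)
    (B : Matrix (Fin p) (Fin q) ℝ)
    (hB : LinearIndependent ℝ B)
    (S : Matrix (Fin p) (Fin p) ℝ) (hS : S = B * Bᵀ)
    (z : Fin p → ℝ)
    (xwls : Fin n → ℝ)
    (hxwls : xwls = ((Hᵀ * S⁻¹ * H)⁻¹ * Hᵀ * S⁻¹) *ᵥ z) :
    ∃ xw : ℝ → (Fin n → ℝ) × (Fin q → ℝ),
      (∀ ε : ℝ, 0 < ε →
        (H *ᵥ (xw ε).1 + ε • (B *ᵥ (xw ε).2) = z ∧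
          (∀ (y : Fin n → ℝ) (u : Fin q → ℝ),
            H *ᵥ y + ε • (B *ᵥ u) = 0 → (xw ε).1 ⬝ᵥ y + (xw ε).2 ⬝ᵥ u = 0)) ∧
        (∀ (x' : Fin n → ℝ) (w' : Fin q → ℝ),
          (H *ᵥ x' + ε • (B *ᵥ w') = z ∧
            ∀ (y : Fin n → ℝ) (u : Fin q → ℝ),
              H *ᵥ y + ε • (B *ᵥ u) = 0 → x' ⬝ᵥ y + w' ⬝ᵥ u = 0) →
          (x', w') = xw ε)) ∧
      Filter.Tendsto (fun ε : ℝ => (xw ε).1)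
        (nhdsWithin 0 (Set.Ioi 0)) (nhds xwls) := by
  have hSpos : S.PosDef := by
    rw [hS, ← conjTranspose_eq_transpose_of_trivial]
    exact PosDef.mul_conjTranspose_self B (vecMul_injective_iff.2 hB)
  have hMpos : (Hᵀ * S⁻¹ * H).PosDef := by
    rw [← conjTranspose_eq_transpose_of_trivial]
    refine hSpos.inv.conjTranspose_mul_mul_same ?_
    exact (injective_iff_map_eq_zero H.mulVecLin).2 hH
  set M := Hᵀ * S⁻¹ * H
  let N : ℝ → Matrix (Fin n) (Fin n) ℝ := fun ε => M + ε ^ 2 • 1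
  let x : ℝ → Fin n → ℝ := fun ε => (N ε)⁻¹ *ᵥ ((Hᵀ * S⁻¹) *ᵥ z)
  have hsol (ε : ℝ) (hε : 0 < ε) := by
    refine regularized_solution H B S hS hSpos.det_pos.ne'.isUnit z hε.ne' (x ε) ?_
    have hN : (N ε).PosDef := hMpos.add (PosDef.one.smul (pow_pos hε 2))
    change N ε *ᵥ ((N ε)⁻¹ *ᵥ _) = _
    rw [mulVec_mulVec, mul_nonsing_inv _ hN.det_pos.ne'.isUnit, one_mulVec]
  refine ⟨fun ε => (x ε, ε⁻¹ • (Bᵀ *ᵥ (S⁻¹ *ᵥ (z - H *ᵥ x ε)))), fun ε hε => ⟨hsol ε hε, ?_⟩, ?_⟩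
  · rintro x' w' ⟨h', ho'⟩
    exact orthogonal_solution_unique H B ε z (hsol ε hε).1 (hsol ε hε).2 h' ho'
  · have hN0 : N 0 = M := by simp [N]
    have hx0 : x 0 = xwls := by
      simp only [x, hN0, hxwls, mulVec_mulVec, Matrix.mul_assoc]
    have hNcont : Continuous N := by fun_prop
    have hinv : ContinuousAt (fun ε => (N ε)⁻¹) 0 := by
      have hdet : (N 0).det ≠ 0 := hN0 ▸ hMpos.det_pos.ne'
      simp only [inv_def, Ring.inverse_eq_inv']
      exact (hNcont.matrix_det.continuousAt.inv₀ hdet).smul hNcont.matrix_adjugate.continuousAt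
    have hxcont : ContinuousAt x 0 :=
      (continuous_id.matrix_mulVec continuous_const).continuousAt.comp hinv
    exact hx0 ▸ hxcont.tendsto.mono_left nhdsWithin_le_nhds
end
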